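/- There exists L₀ > 0 such that for every L ≥ L₀ the following holds: if u is a C² function on an open neighborhood of [0,3L] × ℝ in ℝ² that is 2π-periodic in its second variable θ and harmonic, and if the circle means vanish at t = L and t = 2L, i.e. ∫_0^{2π} u(L,θ) dθ = 0 and ∫_0^{2π} u(2L,θ) dθ = 0, then ‖u‖₁,₂² ≤ (1/2) e^{-L} (‖u‖₁,₁² + ‖u‖₁,₃²). -/

import Mathlib

open Real MeasureTheory

/-- Squared `W^{1,2}`-norm of `u` over the cylinder piece `[(i-1)L, iL] × [0, 2π]`:
`‖u‖₁,ᵢ² = ∫_{(i-1)L}^{iL} ∫_0^{2π} (|u|² + |∂_t u|² + |∂_θ u|²) dθ dt`. -/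
noncomputable def normOneSq (L : ℝ) (i : ℕ) (u : ℝ × ℝ → ℝ) : ℝ :=
  ∫ t in (((i : ℝ) - 1) * L)..((i : ℝ) * L), ∫ θ in (0 : ℝ)..(2 * π),
    (u (t, θ)) ^ 2 + (fderiv ℝ u (t, θ) (1, 0)) ^ 2 + (fderiv ℝ u (t, θ) (0, 1)) ^ 2

/-- `u` is harmonic at `p`: `∂²u/∂t² + ∂²u/∂θ² = 0` at `p`. -/
def IsHarmonicAt (u : ℝ × ℝ → ℝ) (p : ℝ × ℝ) : Prop :=
  fderiv ℝ (fun q => fderiv ℝ u q (1, 0)) p (1, 0) +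
    fderiv ℝ (fun q => fderiv ℝ u q (0, 1)) p (0, 1) = 0

open Set Filter Topology Complex in
theorem hasDerivAt_fourierCoeffOn_of_continuousOn {a b T : ℝ} (hab : a < b) {g h : ℝ × ℝ → ℝ}
    (hg : ContinuousOn g (Icc 0 T ×ˢ univ)) (hh : ContinuousOn h (Icc 0 T ×ˢ univ))
    (hd : ∀ t ∈ Ioo 0 T, ∀ θ, HasDerivAt (fun s => g (s, θ)) (h (t, θ)) t)
    (n : ℤ) {t : ℝ} (ht : t ∈ Ioo 0 T) :
    HasDerivAt (fun s => fourierCoeffOn hab (fun θ => (g (s, θ) : ℂ)) n)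
      (fourierCoeffOn hab (fun θ => (h (t, θ) : ℂ)) n) t := by
  simp only [fourierCoeffOn_eq_integral]
  refine HasDerivAt.const_smul (1 / (b - a)) ?_
  have hslice : ∀ {k : ℝ × ℝ → ℝ}, ContinuousOn k (Icc 0 T ×ˢ univ) → ∀ s ∈ Ioo 0 T,
      Continuous fun θ : ℝ => fourier (-n) (θ : AddCircle (b - a)) • (k (s, θ) : ℂ) := by
    intro k hk s hs
    have h1 : Continuous fun θ : ℝ => k (s, θ) :=
      hk.comp_continuous (by fun_prop) fun θ => ⟨Ioo_subset_Icc_self hs, mem_univ _⟩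
    have h2 : Continuous fun θ : ℝ => fourier (-n) (θ : AddCircle (b - a)) :=
      (map_continuous _).comp (AddCircle.continuous_mk' _)
    exact h2.smul (continuous_ofReal.comp h1)
  obtain ⟨C, hC⟩ := (isCompact_Icc.prod isCompact_uIcc).exists_bound_of_continuousOn
    (hh.mono (prod_mono_right (subset_univ (uIcc a b))))
  refine (intervalIntegral.hasDerivAt_integral_of_dominated_loc_of_deriv_le
    (F := fun s θ => fourier (-n) (θ : AddCircle (b - a)) • (g (s, θ) : ℂ))
    (F' := fun s θ => fourier (-n) (θ : AddCircle (b - a)) • (h (s, θ) : ℂ))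
    (bound := fun _ => C) (Ioo_mem_nhds ht.1 ht.2) ?_ ((hslice hg t ht).intervalIntegrable _ _)
    (hslice hh t ht).aestronglyMeasurable ?_ intervalIntegrable_const ?_).2
  · filter_upwards [Ioo_mem_nhds ht.1 ht.2] with s hs
    exact (hslice hg s hs).aestronglyMeasurable
  · refine ae_of_all _ fun θ hθ s hs => ?_
    have := hC (s, θ) ⟨Ioo_subset_Icc_self hs, uIoc_subset_uIcc hθ⟩
    have h1 : ‖fourier (-n) (θ : AddCircle (b - a))‖ = 1 := by
      rw [fourier_apply]
      exact Circle.norm_coe _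
    rw [norm_smul, h1, one_mul, norm_real]
    exact this
  · refine ae_of_all _ fun θ _ s hs => ?_
    exact ((hd s hs θ).ofReal_comp).const_mul _

open Set Complex in
theorem fourierCoeffOn_deriv_of_eq_endpoints {f f' : ℝ → ℝ}
    (hf : ∀ θ, HasDerivAt f (f' θ) θ) (hf' : Continuous f') (hper : f (2 * π) = f 0) (n : ℤ) :
    fourierCoeffOn two_pi_pos (fun θ => (f' θ : ℂ)) n =
      I * n * fourierCoeffOn two_pi_pos (fun θ => (f θ : ℂ)) n := by
  have hd : ∀ θ, HasDerivAt (fun θ => (f θ : ℂ)) (f' θ : ℂ) θ := fun θ => (hf θ).ofReal_comp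
  have hi : IntervalIntegrable (fun θ => (f' θ : ℂ)) volume 0 (2 * π) :=
    (continuous_ofReal.comp hf').intervalIntegrable _ _
  rcases eq_or_ne n 0 with rfl | hn
  · rw [fourierCoeffOn_eq_integral]
    have := intervalIntegral.integral_eq_sub_of_hasDerivAt (fun θ _ => hd θ) hi
    simp only [neg_zero, fourier_zero, one_smul, this, hper]
    simp
  · rw [fourierCoeffOn_of_hasDerivAt two_pi_pos hn (fun θ _ => hd θ) hi, hper]
    have hn' : (n : ℂ) ≠ 0 := by exact_mod_cast hn
    have hpi : (π : ℂ) ≠ 0 := by exact_mod_cast pi_ne_zero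
    push_cast
    field_simp
    simp only [sub_self, mul_zero, sub_zero, zero_sub]
    ring

open Set in
theorem eq_exp_mul_of_hasDerivAt {T a : ℝ} {v : ℝ → ℂ}
    (hv : ∀ t ∈ Ioo 0 T, HasDerivAt v (a * v t) t) {s t : ℝ} (hs : s ∈ Ioo 0 T)
    (ht : t ∈ Ioo 0 T) : v s = Real.exp (a * (s - t)) * v t := by
  have hw : ∀ r ∈ Ioo 0 T, HasDerivAt (fun r => (Real.exp (-(a * r)) : ℂ) * v r) 0 r := by
    intro r hr
    have h1 : HasDerivAt (fun r : ℝ => Real.exp (-(a * r))) (Real.exp (-(a * r)) * -(a * 1)) r :=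
      (((hasDerivAt_id r).const_mul a).neg).exp
    refine (h1.ofReal_comp.mul (hv r hr)).congr_deriv ?_
    push_cast
    ring
  have h := isOpen_Ioo.is_const_of_deriv_eq_zero isPreconnected_Ioo
    (fun r hr => (hw r hr).differentiableAt.differentiableWithinAt) (fun r hr => (hw r hr).deriv)
    hs ht
  have h2 : Real.exp (a * s) * Real.exp (-(a * s)) = 1 := by rw [← Real.exp_add]; simp
  calc v s = ((Real.exp (a * s) * Real.exp (-(a * s)) : ℝ) : ℂ) * v s := by rw [h2]; simp
    _ = Real.exp (a * s) * ((Real.exp (-(a * s)) : ℂ) * v s) := by push_cast; ring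
    _ = Real.exp (a * (s - t)) * v t := by
      have h : (Real.exp (-(a * s)) : ℂ) * v s = Real.exp (-(a * t)) * v t := h
      rw [h, ← mul_assoc, ← Complex.ofReal_mul, ← Real.exp_add]
      ring_nf

theorem exp_le_exp_add_exp_neg {n : ℤ} (hn : n ≠ 0) {x : ℝ} (hx : 0 ≤ x) :
    Real.exp x ≤ Real.exp (n * x) + Real.exp (-(n * x)) := by
  rcases lt_or_gt_of_ne hn with h | h
  · have h1 : (n : ℝ) ≤ -1 := by exact_mod_cast (by lia : n ≤ -1)
    have : Real.exp x ≤ Real.exp (-(n * x)) := Real.exp_le_exp.2 (by nlinarith)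
    linarith [Real.exp_pos (n * x)]
  · have h1 : (1 : ℝ) ≤ n := by exact_mod_cast (by lia : 1 ≤ n)
    have : Real.exp x ≤ Real.exp (n * x) := Real.exp_le_exp.2 (by nlinarith)
    linarith [Real.exp_pos (-(n * x))]

open Set in
/-- Three-point estimate for the energy of a nonconstant mode `c'' = n² c`. -/
theorem mode_energy_three_point {T L t : ℝ} {n : ℤ} (hn : n ≠ 0) (hL : 0 ≤ L) {c c' : ℝ → ℂ}
    (hc : ∀ t ∈ Ioo 0 T, HasDerivAt c (c' t) t)
    (hc' : ∀ t ∈ Ioo 0 T, HasDerivAt c' ((n : ℂ) ^ 2 * c t) t)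
    (h₁ : t - L ∈ Ioo 0 T) (h₂ : t ∈ Ioo 0 T) (h₃ : t + L ∈ Ioo 0 T) :
    (1 + (n : ℝ) ^ 2) * ‖c t‖ ^ 2 + ‖c' t‖ ^ 2 ≤ 2 * Real.exp (-(2 * L)) *
      (((1 + (n : ℝ) ^ 2) * ‖c (t - L)‖ ^ 2 + ‖c' (t - L)‖ ^ 2) +
        ((1 + (n : ℝ) ^ 2) * ‖c (t + L)‖ ^ 2 + ‖c' (t + L)‖ ^ 2)) := by
  have hn1 : (1 : ℝ) ≤ (n : ℝ) ^ 2 := by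
    have : (1 : ℤ) ≤ n ^ 2 := by have := sq_pos_of_ne_zero hn; lia
    exact_mod_cast this
  have hp : ∀ t ∈ Ioo 0 T, HasDerivAt (fun t => c' t + n * c t)
      (((n : ℝ) : ℂ) * (c' t + n * c t)) t := by
    intro t ht
    refine ((hc' t ht).add ((hc t ht).const_mul (n : ℂ))).congr_deriv ?_
    push_cast
    ring
  have hm : ∀ t ∈ Ioo 0 T, HasDerivAt (fun t => c' t - n * c t)
      (((-n : ℝ) : ℂ) * (c' t - n * c t)) t := by
    intro t ht
    refine ((hc' t ht).sub ((hc t ht).const_mul (n : ℂ))).congr_deriv ?_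
    push_cast
    ring
  have para : ∀ s, ‖c' s + n * c s‖ ^ 2 + ‖c' s - n * c s‖ ^ 2 =
      2 * (‖c' s‖ ^ 2 + (n : ℝ) ^ 2 * ‖c s‖ ^ 2) := by
    intro s
    have := parallelogram_law_with_norm ℝ (c' s) (n * c s)
    rw [norm_mul, Complex.norm_intCast] at this
    rw [← sq_abs (n : ℝ)]
    linear_combination this
  have normexp : ∀ (x : ℝ) (z : ℂ), ‖(Real.exp x : ℂ) * z‖ ^ 2 = Real.exp (2 * x) * ‖z‖ ^ 2 := by
    intro x z
    rw [norm_mul, Complex.norm_real, Real.norm_of_nonneg (Real.exp_pos x).le, mul_pow,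
      ← Real.exp_nat_mul]
    norm_num
  have e1 := para (t - L)
  have e3 := para (t + L)
  have e2 := para t
  rw [eq_exp_mul_of_hasDerivAt hp h₁ h₂, eq_exp_mul_of_hasDerivAt hm h₁ h₂, normexp, normexp] at e1
  rw [eq_exp_mul_of_hasDerivAt hp h₃ h₂, eq_exp_mul_of_hasDerivAt hm h₃ h₂, normexp, normexp] at e3
  set P := ‖c' t + n * c t‖ ^ 2
  set Q := ‖c' t - n * c t‖ ^ 2
  have hP : 0 ≤ P := by positivity
  have hQ : 0 ≤ Q := by positivity
  rw [show 2 * ((n : ℝ) * (t - L - t)) = -(n * (2 * L)) by ring,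
    show 2 * (-(n : ℝ) * (t - L - t)) = n * (2 * L) by ring] at e1
  rw [show 2 * ((n : ℝ) * (t + L - t)) = n * (2 * L) by ring,
    show 2 * (-(n : ℝ) * (t + L - t)) = -(n * (2 * L)) by ring] at e3
  have hexp := exp_le_exp_add_exp_neg hn (show 0 ≤ 2 * L by positivity)
  have hE : Real.exp (-(2 * L)) * Real.exp (2 * L) = 1 := by rw [← Real.exp_add]; simp
  have hpos := Real.exp_pos (-(2 * L))
  have key : Real.exp (2 * L) * (P + Q) / 2 ≤
      (((1 + (n : ℝ) ^ 2) * ‖c (t - L)‖ ^ 2 + ‖c' (t - L)‖ ^ 2) +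
        ((1 + (n : ℝ) ^ 2) * ‖c (t + L)‖ ^ 2 + ‖c' (t + L)‖ ^ 2)) := by
    have := mul_le_mul_of_nonneg_right hexp (add_nonneg hP hQ)
    nlinarith [sq_nonneg ‖c (t - L)‖, sq_nonneg ‖c (t + L)‖]
  have left : (1 + (n : ℝ) ^ 2) * ‖c t‖ ^ 2 + ‖c' t‖ ^ 2 ≤ P + Q := by
    nlinarith [sq_nonneg ‖c t‖, sq_nonneg ‖c' t‖,
      mul_le_mul_of_nonneg_right hn1 (sq_nonneg ‖c t‖)]
  calc _ ≤ P + Q := left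
    _ = 2 * Real.exp (-(2 * L)) * (Real.exp (2 * L) * (P + Q) / 2) := by
      linear_combination (-(P + Q)) * hE
    _ ≤ _ := by gcongr

open Set in
theorem eq_zero_of_affine_of_two_zeros {T a b : ℝ} {c c' : ℝ → ℂ}
    (hc : ∀ t ∈ Ioo 0 T, HasDerivAt c (c' t) t) (hc' : ∀ t ∈ Ioo 0 T, HasDerivAt c' 0 t)
    (ha : a ∈ Ioo 0 T) (hb : b ∈ Ioo 0 T) (hab : a ≠ b) (hca : c a = 0) (hcb : c b = 0)
    {t : ℝ} (ht : t ∈ Ioo 0 T) : c t = 0 ∧ c' t = 0 := by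
  have hconst : ∀ s ∈ Ioo 0 T, c' s = c' a := fun s hs =>
    isOpen_Ioo.is_const_of_deriv_eq_zero isPreconnected_Ioo
      (fun r hr => (hc' r hr).differentiableAt.differentiableWithinAt)
      (fun r hr => (hc' r hr).deriv) hs ha
  have hw : ∀ r ∈ Ioo 0 T, HasDerivAt (fun r : ℝ => c r - (r : ℂ) * c' a) 0 r := by
    intro r hr
    refine ((hc r hr).sub ((hasDerivAt_id r).ofReal_comp.mul_const (c' a))).congr_deriv ?_
    rw [hconst r hr]
    simp
  have haff : ∀ s ∈ Ioo 0 T, c s - (s : ℂ) * c' a = c a - (a : ℂ) * c' a := fun s hs =>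
    isOpen_Ioo.is_const_of_deriv_eq_zero isPreconnected_Ioo
      (fun r hr => (hw r hr).differentiableAt.differentiableWithinAt)
      (fun r hr => (hw r hr).deriv) hs ha
  have h0 : c' a = 0 := by
    have h1 := haff b hb
    rw [hca, hcb] at h1
    have h2 : ((a : ℂ) - b) * c' a = 0 := by linear_combination h1
    exact (mul_eq_zero.1 h2).resolve_left (sub_ne_zero.2 (by exact_mod_cast hab))
  refine ⟨?_, (hconst t ht).trans h0⟩
  have h1 := haff t ht
  rw [h0, hca] at h1
  simpa using h1

open Set Complex in
theorem hasSum_sq_fourierCoeffOn_of_continuous {f : ℝ → ℝ} (hf : Continuous f) :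
    HasSum (fun n => ‖fourierCoeffOn two_pi_pos (fun θ => (f θ : ℂ)) n‖ ^ 2)
      ((2 * π)⁻¹ * ∫ θ in (0 : ℝ)..(2 * π), f θ ^ 2) := by
  have hfc : Continuous fun θ => (f θ : ℂ) := continuous_ofReal.comp hf
  have hL2 : MemLp (fun θ => (f θ : ℂ)) 2 (volume.restrict (Ioc 0 (2 * π))) := by
    obtain ⟨C, hC⟩ := (isCompact_Icc (a := (0 : ℝ)) (b := 2 * π)).exists_bound_of_continuousOn
      hfc.continuousOn
    refine MemLp.of_bound hfc.aestronglyMeasurable C ?_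
    filter_upwards [ae_restrict_mem measurableSet_Ioc] with θ hθ
    exact hC θ (Ioc_subset_Icc_self hθ)
  simpa using hasSum_sq_fourierCoeffOn two_pi_pos hL2

/-- The circle energy `∫₀^{2π} (|u|² + |∂_t u|² + |∂_θ u|²) dθ` at height `t`. -/
noncomputable def circleEnergy (u : ℝ × ℝ → ℝ) (t : ℝ) : ℝ :=
  ∫ θ in (0 : ℝ)..(2 * π),
    (u (t, θ)) ^ 2 + (fderiv ℝ u (t, θ) (1, 0)) ^ 2 + (fderiv ℝ u (t, θ) (0, 1)) ^ 2

open Set in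
theorem continuousOn_intervalIntegral_of_continuousOn_strip {T a b : ℝ} (hT : 0 ≤ T)
    {g : ℝ × ℝ → ℝ} (hg : ContinuousOn g (Icc 0 T ×ˢ univ)) :
    ContinuousOn (fun t => ∫ θ in a..b, g (t, θ)) (Icc 0 T) := by
  have hc : Continuous (Function.uncurry fun t θ : ℝ => g ((projIcc 0 T hT t : ℝ), θ)) := by
    refine hg.comp_continuous ?_ fun p => ⟨(projIcc 0 T hT p.1).2, mem_univ _⟩
    exact (continuous_subtype_val.comp (continuous_projIcc.comp continuous_fst)).prodMk
      continuous_snd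
  refine (intervalIntegral.continuous_parametric_intervalIntegral_of_continuous'
    (μ := volume) hc a b).continuousOn.congr fun t ht => ?_
  simp only [projIcc_of_mem hT ht]

section Harmonic

open Set

theorem contDiffOn_fderiv_apply {U : Set (ℝ × ℝ)} {u : ℝ × ℝ → ℝ} (hU : IsOpen U)
    (hu : ContDiffOn ℝ 2 u U) (v : ℝ × ℝ) : ContDiffOn ℝ 1 (fun q => fderiv ℝ u q v) U :=
  (hu.fderiv_of_isOpen hU (by norm_num)).clm_apply contDiffOn_const

theorem ContDiffOn.hasDerivAt_fst {U : Set (ℝ × ℝ)} {g : ℝ × ℝ → ℝ} (hU : IsOpen U)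
    (hg : ContDiffOn ℝ 1 g U) {t θ : ℝ} (h : (t, θ) ∈ U) :
    HasDerivAt (fun s => g (s, θ)) (fderiv ℝ g (t, θ) (1, 0)) t := by
  have h1 := ((hg.contDiffAt (hU.mem_nhds h)).differentiableAt one_ne_zero).hasFDerivAt
  exact h1.comp_hasDerivAt t ((hasDerivAt_id t).prodMk (hasDerivAt_const t θ))

theorem ContDiffOn.hasDerivAt_snd {U : Set (ℝ × ℝ)} {g : ℝ × ℝ → ℝ} (hU : IsOpen U)
    (hg : ContDiffOn ℝ 1 g U) {t θ : ℝ} (h : (t, θ) ∈ U) :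
    HasDerivAt (fun s => g (t, s)) (fderiv ℝ g (t, θ) (0, 1)) θ := by
  have h1 := ((hg.contDiffAt (hU.mem_nhds h)).differentiableAt one_ne_zero).hasFDerivAt
  exact h1.comp_hasDerivAt θ ((hasDerivAt_const θ t).prodMk (hasDerivAt_id θ))

theorem continuousOn_energy_density {U : Set (ℝ × ℝ)} {u : ℝ × ℝ → ℝ} (hU : IsOpen U)
    (hu : ContDiffOn ℝ 2 u U) :
    ContinuousOn (fun p => (u p) ^ 2 + (fderiv ℝ u p (1, 0)) ^ 2 + (fderiv ℝ u p (0, 1)) ^ 2) U :=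
  ((hu.continuousOn.pow 2).add ((contDiffOn_fderiv_apply hU hu _).continuousOn.pow 2)).add
    ((contDiffOn_fderiv_apply hU hu _).continuousOn.pow 2)

/-- Pointwise-in-`t` three-circle estimate. -/
theorem circleEnergy_three_point {T L : ℝ} {U : Set (ℝ × ℝ)} {u : ℝ × ℝ → ℝ} (hU : IsOpen U)
    (hTU : Icc (0 : ℝ) T ×ˢ (univ : Set ℝ) ⊆ U) (hu : ContDiffOn ℝ 2 u U)
    (hper : ∀ t θ : ℝ, u (t, θ + 2 * π) = u (t, θ)) (hharm : ∀ p ∈ U, IsHarmonicAt u p)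
    {a b : ℝ} (ha : a ∈ Ioo 0 T) (hb : b ∈ Ioo 0 T) (hab : a ≠ b)
    (hma : (∫ θ in (0 : ℝ)..(2 * π), u (a, θ)) = 0)
    (hmb : (∫ θ in (0 : ℝ)..(2 * π), u (b, θ)) = 0) (hL : 0 ≤ L) {t : ℝ}
    (h₁ : t - L ∈ Ioo 0 T) (h₂ : t ∈ Ioo 0 T) (h₃ : t + L ∈ Ioo 0 T) :
    circleEnergy u t ≤
      2 * Real.exp (-(2 * L)) * (circleEnergy u (t - L) + circleEnergy u (t + L)) := by
  have hmem : ∀ t ∈ Ioo 0 T, ∀ θ : ℝ, (t, θ) ∈ U := fun t ht θ =>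
    hTU ⟨Ioo_subset_Icc_self ht, mem_univ _⟩
  have hslice : ∀ {k : ℝ × ℝ → ℝ}, ContinuousOn k U → ∀ s ∈ Ioo 0 T,
      Continuous fun θ : ℝ => k (s, θ) := fun hk s hs =>
    hk.comp_continuous (by fun_prop) (hmem s hs)
  have hut := contDiffOn_fderiv_apply hU hu (1, 0)
  have huθ := contDiffOn_fderiv_apply hU hu (0, 1)
  have hutt := hut.continuousOn_fderiv_of_isOpen hU le_rfl |>.clm_apply
    (continuousOn_const (c := ((1 : ℝ), (0 : ℝ))))
  have huθθ := huθ.continuousOn_fderiv_of_isOpen hU le_rfl |>.clm_apply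
    (continuousOn_const (c := ((0 : ℝ), (1 : ℝ))))
  have hu1 : ContDiffOn ℝ 1 u U := hu.of_le (by norm_num)
  set ut : ℝ × ℝ → ℝ := fun q => fderiv ℝ u q (1, 0) with hut_def
  set uθ : ℝ × ℝ → ℝ := fun q => fderiv ℝ u q (0, 1) with huθ_def
  let coeff (g : ℝ × ℝ → ℝ) (n : ℤ) (s : ℝ) : ℂ :=
    fourierCoeffOn two_pi_pos (fun θ => (g (s, θ) : ℂ)) n
  have hper_uθ : ∀ s, uθ (s, 2 * π) = uθ (s, 0) := by
    intro s
    have h1 : (fun q : ℝ × ℝ => u (q + (0, 2 * π))) = u := by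
      ext q
      rw [← hper q.1 q.2]
      congr 1
      ext <;> simp
    have h2 := fderiv_comp_add_right (𝕜 := ℝ) (f := u) (x := (s, 0)) (0, 2 * π)
    rw [h1] at h2
    simp only [huθ_def, h2, Prod.mk_add_mk, add_zero, zero_add]
  have hcoeffθ : ∀ s ∈ Ioo 0 T, ∀ n, coeff uθ n s = Complex.I * n * coeff u n s := fun s hs n =>
    fourierCoeffOn_deriv_of_eq_endpoints (fun θ => hu1.hasDerivAt_snd hU (hmem s hs θ))
      (hslice huθ.continuousOn s hs) (by simpa using hper s 0) n
  have hc : ∀ n, ∀ s ∈ Ioo 0 T, HasDerivAt (coeff u n) (coeff ut n s) s := fun n s hs =>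
    hasDerivAt_fourierCoeffOn_of_continuousOn two_pi_pos (hu.continuousOn.mono hTU)
      (hut.continuousOn.mono hTU) (fun r hr θ => hu1.hasDerivAt_fst hU (hmem r hr θ)) n hs
  have hc' : ∀ n : ℤ, ∀ s ∈ Ioo 0 T, HasDerivAt (coeff ut n) ((n : ℂ) ^ 2 * coeff u n s) s := by
    intro n s hs
    have h1 := hasDerivAt_fourierCoeffOn_of_continuousOn two_pi_pos (hut.continuousOn.mono hTU)
      (hutt.mono hTU) (fun r hr θ => hut.hasDerivAt_fst hU (hmem r hr θ)) n hs
    convert h1 using 1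
    have h2 : (fun θ => ((fderiv ℝ ut (s, θ) (1, 0) : ℝ) : ℂ)) =
        (-1 : ℂ) • fun θ => ((fderiv ℝ uθ (s, θ) (0, 1) : ℝ) : ℂ) := by
      ext θ
      have h3 : fderiv ℝ ut (s, θ) (1, 0) + fderiv ℝ uθ (s, θ) (0, 1) = 0 :=
        hharm _ (hmem s hs θ)
      rw [eq_neg_of_add_eq_zero_left h3]
      simp
    rw [h2, fourierCoeffOn.const_smul, fourierCoeffOn_deriv_of_eq_endpoints
      (fun θ => huθ.hasDerivAt_snd hU (hmem s hs θ)) (hslice huθθ s hs) (hper_uθ s) n]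
    have h4 : fourierCoeffOn two_pi_pos (fun θ => (uθ (s, θ) : ℂ)) n =
      Complex.I * n * coeff u n s := hcoeffθ s hs n
    rw [h4, smul_eq_mul]
    linear_combination ((n : ℂ) ^ 2 * coeff u n s) * Complex.I_sq
  have hsum : ∀ s ∈ Ioo 0 T, HasSum
      (fun n : ℤ => (1 + (n : ℝ) ^ 2) * ‖coeff u n s‖ ^ 2 + ‖coeff ut n s‖ ^ 2)
      ((2 * π)⁻¹ * circleEnergy u s) := by
    intro s hs
    have c0 := hslice hu.continuousOn s hs
    have c1 := hslice hut.continuousOn s hs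
    have c2 := hslice huθ.continuousOn s hs
    have h := ((hasSum_sq_fourierCoeffOn_of_continuous c0).add
      (hasSum_sq_fourierCoeffOn_of_continuous c1)).add (hasSum_sq_fourierCoeffOn_of_continuous c2)
    convert h using 1
    · ext n
      have h5 : fourierCoeffOn two_pi_pos (fun θ => (uθ (s, θ) : ℂ)) n =
        Complex.I * n * coeff u n s := hcoeffθ s hs n
      rw [h5, norm_mul, norm_mul, Complex.norm_I, Complex.norm_intCast, mul_pow, mul_pow, sq_abs]
      ring
    · have i0 : IntervalIntegrable (fun θ => u (s, θ) ^ 2) volume 0 (2 * π) :=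
        (c0.pow 2).intervalIntegrable _ _
      have i1 : IntervalIntegrable (fun θ => ut (s, θ) ^ 2) volume 0 (2 * π) :=
        (c1.pow 2).intervalIntegrable _ _
      have i2 : IntervalIntegrable (fun θ => uθ (s, θ) ^ 2) volume 0 (2 * π) :=
        (c2.pow 2).intervalIntegrable _ _
      rw [← mul_add, ← mul_add, ← intervalIntegral.integral_add i0 i1,
        ← intervalIntegral.integral_add (i0.add i1) i2]
      rfl
  have hzero : ∀ s ∈ Ioo 0 T, coeff u 0 s = 0 ∧ coeff ut 0 s = 0 := by
    have hmean : ∀ r, (∫ θ in (0 : ℝ)..(2 * π), u (r, θ)) = 0 → coeff u 0 r = 0 := by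
      intro r hr
      simp only [coeff, fourierCoeffOn_eq_integral, neg_zero, fourier_zero, one_smul,
        intervalIntegral.integral_ofReal, hr, Complex.ofReal_zero, smul_zero]
    intro s hs
    exact eq_zero_of_affine_of_two_zeros (hc 0) (fun r hr => by simpa using hc' 0 r hr) ha hb hab
      (hmean a hma) (hmean b hmb) hs
  have hle := hasSum_le (fun n => ?_) (hsum t h₂)
    (((hsum _ h₁).add (hsum _ h₃)).mul_left (2 * Real.exp (-(2 * L))))
  · rw [← mul_add, mul_left_comm] at hle
    exact le_of_mul_le_mul_left hle (by positivity)
  · rcases eq_or_ne n 0 with rfl | hn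
    · simp [hzero _ h₁, hzero _ h₂, hzero _ h₃]
    · exact mode_energy_three_point hn hL (hc n) (hc' n) h₁ h₂ h₃

end Harmonic

/-- There exists `L₀ > 0` such that for every `L ≥ L₀`, any `C²` function on a neighborhood of
`[0,3L] × ℝ`, `2π`-periodic in `θ`, harmonic, and whose circle means vanish at `t = L` and
`t = 2L`, satisfies `‖u‖₁,₂² ≤ (1/2) e^{-L} (‖u‖₁,₁² + ‖u‖₁,₃²)`. -/
theorem harmonic_three_annuli_estimate_mean_zero :
    ∃ L₀ : ℝ, 0 < L₀ ∧ ∀ L : ℝ, L₀ ≤ L →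
      ∀ (U : Set (ℝ × ℝ)) (u : ℝ × ℝ → ℝ),
        IsOpen U → (Set.Icc (0 : ℝ) (3 * L)) ×ˢ (Set.univ : Set ℝ) ⊆ U →
        ContDiffOn ℝ 2 u U →
        (∀ t θ : ℝ, u (t, θ + 2 * π) = u (t, θ)) →
        (∀ p ∈ U, IsHarmonicAt u p) →
        (∫ θ in (0 : ℝ)..(2 * π), u (L, θ)) = 0 →
        (∫ θ in (0 : ℝ)..(2 * π), u (2 * L, θ)) = 0 →
        normOneSq L 2 u ≤
          (1 / 2) * Real.exp (-L) * (normOneSq L 1 u + normOneSq L 3 u) := by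
  refine ⟨2, two_pos, fun L hL U u hU hLU hu hper hharm hm₁ hm₂ => ?_⟩
  have hL0 : 0 < L := by linarith
  have hcont : ContinuousOn (circleEnergy u) (Set.Icc 0 (3 * L)) :=
    continuousOn_intervalIntegral_of_continuousOn_strip (by positivity)
      ((continuousOn_energy_density hU hu).mono hLU)
  have hnonneg : ∀ t, 0 ≤ circleEnergy u t := fun t =>
    intervalIntegral.integral_nonneg two_pi_pos.le fun θ _ => by positivity
  have e1 : normOneSq L 1 u = ∫ t in L..2 * L, circleEnergy u (t - L) := by
    rw [intervalIntegral.integral_comp_sub_right (circleEnergy u) L]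
    simp only [normOneSq, circleEnergy]
    norm_num
    congr 1
    ring
  have e2 : normOneSq L 2 u = ∫ t in L..2 * L, circleEnergy u t := by
    simp only [normOneSq, circleEnergy]
    norm_num
  have e3 : normOneSq L 3 u = ∫ t in L..2 * L, circleEnergy u (t + L) := by
    rw [intervalIntegral.integral_comp_add_right (circleEnergy u) L]
    simp only [normOneSq, circleEnergy]
    norm_num
    congr 1 <;> ring
  have hLe : L ≤ 2 * L := by linarith
  have i1 : IntervalIntegrable (fun t => circleEnergy u (t - L)) volume L (2 * L) := by
    refine ContinuousOn.intervalIntegrable_of_Icc hLe (hcont.comp (by fun_prop) ?_)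
    intro t ht
    constructor <;> linarith [ht.1, ht.2]
  have i3 : IntervalIntegrable (fun t => circleEnergy u (t + L)) volume L (2 * L) := by
    refine ContinuousOn.intervalIntegrable_of_Icc hLe (hcont.comp (by fun_prop) ?_)
    intro t ht
    constructor <;> linarith [ht.1, ht.2]
  have i2 : IntervalIntegrable (circleEnergy u) volume L (2 * L) := by
    refine ContinuousOn.intervalIntegrable_of_Icc hLe (hcont.mono ?_)
    intro t ht
    constructor <;> linarith [ht.1, ht.2]
  have hconst : 2 * Real.exp (-(2 * L)) ≤ 1 / 2 * Real.exp (-L) := by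
    have h1 : Real.exp (-L) * Real.exp L = 1 := by rw [← Real.exp_add]; simp
    have h2 : Real.exp (-(2 * L)) = Real.exp (-L) * Real.exp (-L) := by
      rw [← Real.exp_add]; ring_nf
    have h3 : 4 ≤ Real.exp L := by
      have h4 : Real.exp L = Real.exp (L / 2) * Real.exp (L / 2) := by
        rw [← Real.exp_add]; ring_nf
      nlinarith [Real.add_one_le_exp (L / 2)]
    nlinarith [Real.exp_pos (-L)]
  rw [e1, e2, e3, ← intervalIntegral.integral_add i1 i3, ← intervalIntegral.integral_const_mul]
  refine intervalIntegral.integral_mono_on_of_le_Ioo hLe i2 ((i1.add i3).const_mul _) fun t ht => ?_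
  refine (circleEnergy_three_point hU hLU hu hper hharm (a := L) (b := 2 * L) ⟨?_, ?_⟩ ⟨?_, ?_⟩ ?_
    hm₁ hm₂ hL0.le ⟨?_, ?_⟩ ⟨?_, ?_⟩ ⟨?_, ?_⟩).trans
    (mul_le_mul_of_nonneg_right hconst (add_nonneg (hnonneg _) (hnonneg _))) <;>
  linarith [ht.1, ht.2]
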